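/- Smooth approximation of the nonstationary VAR(∞) parameters (Theorem 3.6(i)). Fix K < ∞, κ > 3, 0 < λ_inf ≤ λ_sup < ∞ and N₀ ∈ ℕ. There exists a constant 𝒦 < ∞, depending only on K, κ, λ_inf, λ_sup, such that whenever Assumption LS(p, K, κ, λ_inf, λ_sup, N₀) holds, for all N ≥ N₀, all T ∈ ℤ and all j ≥ 1: ‖Σ_T^(N) − Σ(T/N)‖₂ ≤ 𝒦/N and ‖Φ^(N)_{T,j} − Φ_j(T/N)‖₂ ≤ 𝒦 ζ(j)^{κ−2} min(2ζ(j), 1/N). -/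

import Mathlib

noncomputable section

/-- `⟨x⟩ = max(1,|x|)` -/
def gu (x : ℝ) : ℝ := max 1 |x|

/-- `ζ(x) = max(1, log⟨x⟩)/⟨x⟩` -/
def zeta (x : ℝ) : ℝ := max 1 (Real.log (gu x)) / gu x

/-- spectral norm of a matrix -/
def specNorm {𝕜 : Type*} [RCLike 𝕜] {m n : Type*} [Fintype m] [Fintype n] [DecidableEq n]
    (M : Matrix m n 𝕜) : ℝ :=
  ‖LinearMap.toContinuousLinearMap (Matrix.toEuclideanLin M)‖

/-- `ℓ²(ι; ℝ^p)` -/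
abbrev HpI (ι : Type) (p : ℕ) : Type := lp (fun _ : ι => EuclideanSpace ℝ (Fin p)) 2

abbrev Hp (p : ℕ) : Type := HpI ℤ p

/-- the sequence `δ_t ⊗ e_a` -/
def bvec {ι : Type} [DecidableEq ι] (p : ℕ) (t : ι) (a : Fin p) : HpI ι p :=
  lp.single 2 t (EuclideanSpace.single a 1)

/-- the `p × p` block `A_{t,τ}` of an operator -/
def blk {ι : Type} [DecidableEq ι] {p : ℕ} (A : HpI ι p →L[ℝ] HpI ι p) (t τ : ι) :
    Matrix (Fin p) (Fin p) ℝ :=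
  Matrix.of fun a b => inner (𝕜 := ℝ) (bvec p t a) (A (bvec p τ b))


/-- Assumption LS(p, K, κ, λ_inf, λ_sup, N₀): a locally stationary family of covariance
operators `𝐂^(N)` together with the smooth local autocovariance functions `C_r(·)`. -/
structure AssumptionLS (p : ℕ) (K κ lamInf lamSup : ℝ) (N₀ : ℕ)
    (C : ℕ → Hp p →L[ℝ] Hp p) (Cr : ℤ → ℝ → Matrix (Fin p) (Fin p) ℝ) : Prop where
  symm : ∀ (N : ℕ) (x y : Hp p), inner (𝕜 := ℝ) ((C N) x) y = inner (𝕜 := ℝ) x ((C N) y)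
  lower : ∀ N : ℕ, N₀ ≤ N → ∀ v : Hp p, lamInf * ‖v‖ ^ 2 ≤ inner (𝕜 := ℝ) v ((C N) v)
  upper : ∀ N : ℕ, N₀ ≤ N → ∀ v : Hp p, inner (𝕜 := ℝ) v ((C N) v) ≤ lamSup * ‖v‖ ^ 2
  decay : ∀ N : ℕ, 1 ≤ N → ∀ t τ : ℤ,
    specNorm (blk (C N) t τ) ≤ K * gu ((t : ℝ) - (τ : ℝ)) ^ (-κ)
  crSymm : ∀ (r : ℤ) (u : ℝ), Cr r u = (Cr (-r) u).transpose
  crBound : ∀ (r : ℤ) (u : ℝ), specNorm (Cr r u) ≤ K * gu (r : ℝ) ^ (-κ)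
  crLip : ∀ (r : ℤ) (u v : ℝ),
    specNorm (Cr r u - Cr r v) ≤ K * |u - v| * gu (r : ℝ) ^ (-κ)
  approx : ∀ N : ℕ, 1 ≤ N → ∀ t τ : ℤ,
    specNorm (blk (C N) t τ - Cr (t - τ) ((t : ℝ) / (N : ℝ))) ≤
      K * gu ((t : ℝ) - (τ : ℝ)) ^ (-κ + 1) *
        min (1 / (N : ℝ)) (2 / gu ((t : ℝ) - (τ : ℝ)))

theorem one_le_gu (x : ℝ) : 1 ≤ gu x := le_max_left _ _

theorem gu_pos (x : ℝ) : 0 < gu x := zero_lt_one.trans_le (one_le_gu x)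

theorem abs_le_gu (x : ℝ) : |x| ≤ gu x := le_max_right _ _

theorem gu_neg (x : ℝ) : gu (-x) = gu x := by simp [gu]

theorem gu_add_le (x y : ℝ) : gu (x + y) ≤ 2 * max (gu x) (gu y) := by
  refine max_le ?_ ?_
  · linarith [one_le_gu x, le_max_left (gu x) (gu y)]
  · linarith [abs_add_le x y, abs_le_gu x, abs_le_gu y, le_max_left (gu x) (gu y),
      le_max_right (gu x) (gu y)]

theorem gu_rpow_pos (x s : ℝ) : 0 < gu x ^ s := Real.rpow_pos_of_pos (gu_pos x) s

theorem gu_rpow_anti (x : ℝ) {s t : ℝ} (h : s ≤ t) : gu x ^ (-t) ≤ gu x ^ (-s) :=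
  Real.rpow_le_rpow_of_exponent_le (one_le_gu x) (by linarith)

theorem abs_mul_gu_rpow_le (x s : ℝ) : |x| * gu x ^ (-s) ≤ gu x ^ (-(s - 1)) := by
  calc |x| * gu x ^ (-s) ≤ gu x * gu x ^ (-s) :=
        mul_le_mul_of_nonneg_right (abs_le_gu x) (gu_rpow_pos _ _).le
    _ = gu x ^ (-(s - 1)) := by
        rw [show -(s - 1) = 1 + -s by ring, Real.rpow_add (gu_pos x), Real.rpow_one]

theorem summable_gu {s : ℝ} (hs : 1 < s) : Summable fun r : ℤ => gu (r : ℝ) ^ (-s) := by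
  have h : Summable fun r : ℤ => |(r : ℝ)| ^ (-s) + if r = 0 then 1 else 0 :=
    (Real.summable_abs_int_rpow hs).add (hasSum_ite_eq (0 : ℤ) (1 : ℝ)).summable
  refine Summable.of_nonneg_of_le (fun r => (gu_rpow_pos _ _).le) (fun r => ?_) h
  by_cases hr : r = 0
  · simp only [hr, if_true, Int.cast_zero, abs_zero]
    have : gu 0 = 1 := by simp [gu]
    rw [this, Real.one_rpow]
    have : (0 : ℝ) ≤ 0 ^ (-s) := Real.rpow_nonneg le_rfl _
    linarith
  · have h1 : (1 : ℝ) ≤ |(r : ℝ)| := by exact_mod_cast Int.one_le_abs hr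
    simp [hr, gu, max_eq_right h1]

/-- The total mass of the polynomial weight `r ↦ ⟨r⟩^{-s}` on `ℤ`. -/
def guSum (s : ℝ) : ℝ := ∑' r : ℤ, gu (r : ℝ) ^ (-s)

theorem guSum_pos {s : ℝ} (hs : 1 < s) : 0 < guSum s :=
  (summable_gu hs).tsum_pos (fun _ => (gu_rpow_pos _ _).le) 0 (gu_rpow_pos _ _)

section Weights

variable {ι : Type} {e : ι → ℤ}

theorem summable_gu_comp (he : Function.Injective e) {s : ℝ} (hs : 1 < s) (m : ℤ) :
    Summable fun l => gu ((m : ℝ) - e l) ^ (-s) := by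
  have hi : Function.Injective fun l => m - e l := fun a b h => he (sub_right_injective h)
  simpa [Function.comp_def] using (summable_gu hs).comp_injective hi

theorem tsum_gu_comp_le (he : Function.Injective e) {s : ℝ} (hs : 1 < s) (m : ℤ) :
    ∑' l, gu ((m : ℝ) - e l) ^ (-s) ≤ guSum s := by
  have hi : Function.Injective fun l => m - e l := fun a b h => he (sub_right_injective h)
  simpa [guSum, Function.comp_def] using
    tsum_comp_le_tsum_of_inj (summable_gu hs) (fun _ => (gu_rpow_pos _ _).le) hi

theorem gu_mul_gu_le (a b : ℝ) {s : ℝ} (hs : 0 ≤ s) :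
    gu a ^ (-s) * gu b ^ (-s) ≤
      2 ^ s * gu (a + b) ^ (-s) * (gu a ^ (-s) + gu b ^ (-s)) := by
  have key : ∀ x y : ℝ, gu x ≤ gu y →
      gu x ^ (-s) * gu y ^ (-s) ≤ 2 ^ s * gu (x + y) ^ (-s) * gu x ^ (-s) := by
    intro x y h
    rw [mul_comm]
    refine mul_le_mul_of_nonneg_right ?_ (gu_rpow_pos _ _).le
    have h1 := gu_add_le x y
    rw [max_eq_right h] at h1
    have h2 : gu (x + y) ^ s ≤ 2 ^ s * gu y ^ s := by
      rw [← Real.mul_rpow (by norm_num) (gu_pos y).le]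
      exact Real.rpow_le_rpow (gu_pos _).le h1 hs
    rw [Real.rpow_neg (gu_pos _).le, Real.rpow_neg (gu_pos _).le, ← div_eq_mul_inv,
      le_div_iff₀ (gu_rpow_pos _ _), inv_mul_le_iff₀ (gu_rpow_pos _ _)]
    linarith
  have hp : 0 ≤ 2 ^ s * gu (a + b) ^ (-s) :=
    mul_nonneg (Real.rpow_nonneg (by norm_num) _) (gu_rpow_pos _ _).le
  rcases le_total (gu a) (gu b) with h | h
  · refine (key a b h).trans (mul_le_mul_of_nonneg_left ?_ hp)
    linarith [gu_rpow_pos b (-s)]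
  · have := key b a h
    rw [add_comm b a, mul_comm] at this
    refine this.trans (mul_le_mul_of_nonneg_left ?_ hp)
    linarith [gu_rpow_pos a (-s)]

/-- The constant in the convolution estimate for polynomial weights. -/
def convConst (s : ℝ) : ℝ := 2 ^ s * (2 * guSum s)

theorem convConst_pos {s : ℝ} (hs : 1 < s) : 0 < convConst s :=
  mul_pos (Real.rpow_pos_of_pos (by norm_num) _) (mul_pos two_pos (guSum_pos hs))

theorem norm_le_of_hasSum_conv {F : Type*} [NormedAddCommGroup F] (he : Function.Injective e)
    {s c : ℝ} (hs : 1 < s) (hc : 0 ≤ c) {f : ι → F} {y : F} (hf : HasSum f y) (m n : ℤ)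
    (hb : ∀ l, ‖f l‖ ≤ c * (gu ((m : ℝ) - e l) ^ (-s) * gu ((e l : ℝ) - n) ^ (-s))) :
    ‖y‖ ≤ c * convConst s * gu ((m : ℝ) - n) ^ (-s) := by
  have hsum1 := summable_gu_comp he hs m
  have hsum2 := summable_gu_comp he hs n
  set P := c * (2 ^ s * gu ((m : ℝ) - n) ^ (-s)) with hP
  have hP0 : 0 ≤ P :=
    mul_nonneg hc (mul_nonneg (Real.rpow_nonneg (by norm_num) _) (gu_rpow_pos _ _).le)
  have h1 := ((hsum1.hasSum.add hsum2.hasSum).mul_left P)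
  have h2 : ‖y‖ ≤ _ := hf.norm_le_of_bounded h1 (fun l => by
    refine (hb l).trans ?_
    have h3 := gu_mul_gu_le ((m : ℝ) - e l) ((e l : ℝ) - n) (s := s) (by linarith)
    rw [sub_add_sub_cancel] at h3
    rw [show gu ((n : ℝ) - e l) = gu ((e l : ℝ) - n) by rw [← gu_neg, neg_sub]]
    calc _ ≤ _ := mul_le_mul_of_nonneg_left h3 hc
      _ = _ := by rw [hP]; ring)
  calc ‖y‖ ≤ _ := h2
    _ ≤ P * (guSum s + guSum s) := mul_le_mul_of_nonneg_left
        (add_le_add (tsum_gu_comp_le he hs m) (tsum_gu_comp_le he hs n)) hP0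
    _ = _ := by rw [hP, convConst]; ring

end Weights

section Operators

variable {ι : Type} {p : ℕ}

local notation "𝓔" => EuclideanSpace ℝ (Fin p)

theorem HpI.norm_sq_eq_tsum (w : HpI ι p) : ‖w‖ ^ 2 = ∑' i, ‖w i‖ ^ 2 := by
  have := lp.norm_rpow_eq_tsum (p := 2) (by norm_num) w
  simpa using this

theorem HpI.summable_norm_sq (w : HpI ι p) : Summable fun i => ‖w i‖ ^ 2 := by
  have := (lp.memℓp w).summable (by norm_num)
  simpa using this

theorem HpI.sum_norm_sq_le (w : HpI ι p) (S : Finset ι) : ∑ i ∈ S, ‖w i‖ ^ 2 ≤ ‖w‖ ^ 2 := by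
  rw [HpI.norm_sq_eq_tsum]
  exact (HpI.summable_norm_sq w).sum_le_tsum S (fun _ _ => by positivity)

theorem HpI.norm_apply_le (w : HpI ι p) (i : ι) : ‖w i‖ ≤ ‖w‖ :=
  lp.norm_apply_le_norm (by norm_num) w i

/-- Square-summable families are the coordinates of vectors of `HpI ι p`. -/
theorem HpI.exists_of_summable {f : ι → 𝓔} (hf : Summable fun i => ‖f i‖ ^ 2) :
    ∃ w : HpI ι p, ∀ i, w i = f i := by
  have : Memℓp f 2 := memℓp_gen (by simpa using hf)
  exact ⟨⟨f, this⟩, fun _ => rfl⟩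

theorem HpI.exists_mul (w : HpI ι p) {x : ι → ℝ} {B : ℝ} (hx : ∀ i, |x i| ≤ B) :
    ∃ y : HpI ι p, ∀ i, y i = x i • w i := by
  refine HpI.exists_of_summable (Summable.of_nonneg_of_le (fun _ => by positivity) (fun i => ?_)
    ((HpI.summable_norm_sq w).mul_left (B ^ 2)))
  rw [norm_smul, mul_pow, Real.norm_eq_abs]
  exact mul_le_mul_of_nonneg_right (pow_le_pow_left₀ (abs_nonneg _) (hx i) 2) (by positivity)

/-- Schur test: a kernel dominated by `c ⟨t - τ⟩^{-s}`, `s > 1`, acts boundedly on `ℓ²`. -/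
theorem HpI.exists_kernel_apply {e : ι → ℤ} (he : Function.Injective e) {s c : ℝ} (hs : 1 < s)
    (hc : 0 < c) (M : ι → ι → (𝓔 →L[ℝ] 𝓔))
    (hM : ∀ i l, ‖M i l‖ ≤ c * gu ((e i : ℝ) - e l) ^ (-s)) (w : HpI ι p) :
    ∃ u : HpI ι p, (∀ i, HasSum (fun l => M i l (w l)) (u i)) ∧ ‖u‖ ≤ c * guSum s * ‖w‖ := by
  set G := c * guSum s with hG
  have hG0 : 0 < G := mul_pos hc (guSum_pos hs)
  have hsum : ∀ i, Summable fun l => M i l (w l) := fun i => by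
    refine Summable.of_norm_bounded
      (((summable_gu_comp he hs (e i)).mul_left c).mul_right ‖w‖) (fun l => ?_)
    exact ((M i l).le_opNorm _).trans
      (mul_le_mul (hM i l) (HpI.norm_apply_le w l) (norm_nonneg _)
        (mul_nonneg hc.le (gu_rpow_pos _ _).le))
  have hrow : ∀ (m : ℤ) (F : Finset ι), ∑ l ∈ F, c * gu ((m : ℝ) - e l) ^ (-s) ≤ G := by
    intro m F
    rw [← Finset.mul_sum]
    exact mul_le_mul_of_nonneg_left (((summable_gu_comp he hs m).sum_le_tsum F
      (fun _ _ => (gu_rpow_pos _ _).le)).trans (tsum_gu_comp_le he hs m)) hc.le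
  set f : ι → 𝓔 := fun i => ∑' l, M i l (w l) with hf
  have hf' : ∀ i, HasSum (fun l => M i l (w l)) (f i) := fun i => (hsum i).hasSum
  have hbd : ∀ S : Finset ι, ∑ i ∈ S, ‖f i‖ ^ 2 ≤ (G * ‖w‖) ^ 2 := by
    intro S
    have h1 : HasSum (fun l => ∑ i ∈ S, inner ℝ (f i) (M i l (w l)))
        (∑ i ∈ S, ‖f i‖ ^ 2) := by
      refine hasSum_sum (fun i _ => ?_)
      have := (innerSL ℝ (f i)).hasSum (hf' i)
      simpa [Function.comp_def] using this
    have h2 : ∑ i ∈ S, ‖f i‖ ^ 2 ≤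
        (1 / 2) * ∑ i ∈ S, ‖f i‖ ^ 2 + (1 / 2) * (G * ‖w‖) ^ 2 := by
      refine hasSum_le_of_sum_le h1 (fun F => ?_)
      have hpt : ∀ l i, inner ℝ (f i) (M i l (w l)) ≤
          (c * gu ((e i : ℝ) - e l) ^ (-s)) * (‖f i‖ ^ 2 / (2 * G)) +
          (c * gu ((e l : ℝ) - e i) ^ (-s)) * (G / 2 * ‖w l‖ ^ 2) := by
        intro l i
        rw [show gu ((e l : ℝ) - e i) = gu ((e i : ℝ) - e l) by rw [← gu_neg, neg_sub], ← mul_add]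
        have hg : 0 ≤ c * gu ((e i : ℝ) - e l) ^ (-s) := mul_nonneg hc.le (gu_rpow_pos _ _).le
        calc inner ℝ (f i) (M i l (w l)) ≤ ‖f i‖ * ‖M i l (w l)‖ := real_inner_le_norm _ _
          _ ≤ ‖f i‖ * ((c * gu ((e i : ℝ) - e l) ^ (-s)) * ‖w l‖) :=
              mul_le_mul_of_nonneg_left ((M i l).le_of_opNorm_le (hM i l) _) (norm_nonneg _)
          _ = (c * gu ((e i : ℝ) - e l) ^ (-s)) * (‖f i‖ * ‖w l‖) := by ring
          _ ≤ _ := by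
              refine mul_le_mul_of_nonneg_left ?_ hg
              have : ‖f i‖ ^ 2 / (2 * G) + G / 2 * ‖w l‖ ^ 2 - ‖f i‖ * ‖w l‖ =
                  (‖f i‖ - G * ‖w l‖) ^ 2 / (2 * G) := by
                field_simp
                ring
              have : 0 ≤ (‖f i‖ - G * ‖w l‖) ^ 2 / (2 * G) := by positivity
              linarith
      calc ∑ l ∈ F, ∑ i ∈ S, inner ℝ (f i) (M i l (w l))
          ≤ ∑ l ∈ F, ∑ i ∈ S, ((c * gu ((e i : ℝ) - e l) ^ (-s)) * (‖f i‖ ^ 2 / (2 * G)) +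
          (c * gu ((e l : ℝ) - e i) ^ (-s)) * (G / 2 * ‖w l‖ ^ 2)) :=
            Finset.sum_le_sum fun l _ => Finset.sum_le_sum fun i _ => hpt l i
        _ = ∑ i ∈ S, (∑ l ∈ F, c * gu ((e i : ℝ) - e l) ^ (-s)) * (‖f i‖ ^ 2 / (2 * G)) +
            ∑ l ∈ F, (∑ i ∈ S, c * gu ((e l : ℝ) - e i) ^ (-s)) * (G / 2 * ‖w l‖ ^ 2) := by
            simp_rw [Finset.sum_add_distrib, Finset.sum_mul]
            rw [Finset.sum_comm]
        _ ≤ ∑ i ∈ S, G * (‖f i‖ ^ 2 / (2 * G)) + ∑ l ∈ F, G * (G / 2 * ‖w l‖ ^ 2) := by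
            refine add_le_add (Finset.sum_le_sum fun i _ => ?_) (Finset.sum_le_sum fun l _ => ?_)
            · exact mul_le_mul_of_nonneg_right (hrow _ _) (by positivity)
            · exact mul_le_mul_of_nonneg_right (hrow _ _) (by positivity)
        _ = (1 / 2) * ∑ i ∈ S, ‖f i‖ ^ 2 + (1 / 2) * G ^ 2 * ∑ l ∈ F, ‖w l‖ ^ 2 := by
            rw [Finset.mul_sum, Finset.mul_sum]
            congr 1
            · exact Finset.sum_congr rfl fun i _ => by field_simp
            · exact Finset.sum_congr rfl fun i _ => by ring
        _ ≤ _ := by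
            have := mul_le_mul_of_nonneg_left (HpI.sum_norm_sq_le w F)
              (by positivity : 0 ≤ (1 / 2) * G ^ 2)
            rw [mul_pow]
            linarith
    linarith
  have hfs : Summable fun i => ‖f i‖ ^ 2 :=
    summable_of_sum_le (fun _ => by positivity) hbd
  obtain ⟨u, hu⟩ := HpI.exists_of_summable hfs
  refine ⟨u, fun i => by rw [hu]; exact hf' i, ?_⟩
  refine (sq_le_sq₀ (norm_nonneg _) (by positivity)).mp ?_
  rw [HpI.norm_sq_eq_tsum]
  simp_rw [hu]
  exact hfs.tsum_le_of_sum_le hbd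

variable [DecidableEq ι]

/-- The block `A_{t,τ}` as an operator on `ℝ^p`. -/
def blkCLM (A : HpI ι p →L[ℝ] HpI ι p) (t τ : ι) : 𝓔 →L[ℝ] 𝓔 :=
  Matrix.toEuclideanCLM (𝕜 := ℝ) (blk A t τ)

theorem norm_toEuclideanCLM_eq_specNorm (M : Matrix (Fin p) (Fin p) ℝ) :
    ‖Matrix.toEuclideanCLM (𝕜 := ℝ) M‖ = specNorm M := rfl

theorem blkCLM_apply (A : HpI ι p →L[ℝ] HpI ι p) (t τ : ι) (x : 𝓔) :
    blkCLM A t τ x = A (lp.single 2 τ x) t := by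
  have hx : lp.single 2 τ x = ∑ b, x b • bvec p τ b := by
    have h := congrArg (lp.singleContinuousLinearMap ℝ (fun _ : ι => 𝓔) 2 τ)
      ((EuclideanSpace.basisFun (Fin p) ℝ).sum_repr x).symm
    simpa [map_sum, bvec] using h
  ext a
  rw [hx, map_sum]
  simp only [map_smul, lp.coeFn_sum, Finset.sum_apply, lp.coeFn_smul, Pi.smul_apply]
  have h : ∀ v : HpI ι p, inner ℝ (bvec p t a) v = v t a := fun v => by
    rw [bvec, lp.inner_single_left, EuclideanSpace.inner_single_left]; simp
  simp [blkCLM, blk, h, Matrix.mulVec, dotProduct, mul_comm]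

theorem hasSum_blkCLM (A : HpI ι p →L[ℝ] HpI ι p) (v : HpI ι p) (t : ι) :
    HasSum (fun τ => blkCLM A t τ (v τ)) (A v t) := by
  have h := (lp.evalCLM ℝ (fun _ : ι => 𝓔) 2 t ∘L A).hasSum
    (lp.hasSum_single (by norm_num) v)
  simpa [Function.comp_def, blkCLM_apply] using! h

end Operators

/-- `A` is a coercive operator with polynomially decaying blocks, and `D` is its inverse. The
decay is measured through the injection `e` of the index set into `ℤ`. -/
structure CoerciveDecay (K κ lam : ℝ) {ι : Type} [DecidableEq ι] {p : ℕ} (e : ι → ℤ)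
    (A D : HpI ι p →L[ℝ] HpI ι p) : Prop where
  inj : Function.Injective e
  decay : ∀ i l, ‖blkCLM A i l‖ ≤ K * gu ((e i : ℝ) - e l) ^ (-κ)
  coercive : ∀ v, lam * ‖v‖ ^ 2 ≤ inner ℝ v (A v)
  right_inv : ∀ v, A (D v) = v
  left_inv : ∀ v, D (A v) = v

/-- The inverses of all operators satisfying `CoerciveDecay K κ lam` have blocks decaying like
`⟨t - τ⟩^{-s}`, with a uniform constant. -/
def InverseDecay (K κ lam s : ℝ) : Prop :=
  ∃ c : ℝ, 0 < c ∧ ∀ (ι : Type) [DecidableEq ι] (p : ℕ) (e : ι → ℤ)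
    (A D : HpI ι p →L[ℝ] HpI ι p), CoerciveDecay K κ lam e A D →
      ∀ i k, ‖blkCLM D i k‖ ≤ c * gu ((e i : ℝ) - e k) ^ (-s)

theorem InverseDecay.mono {K κ lam s t : ℝ} (h : InverseDecay K κ lam s) (hts : t ≤ s) :
    InverseDecay K κ lam t := by
  obtain ⟨c, hc, hD⟩ := h
  exact ⟨c, hc, fun ι _ p e A D hAD i k => (hD ι p e A D hAD i k).trans
    (mul_le_mul_of_nonneg_left (gu_rpow_anti _ hts) hc.le)⟩

namespace CoerciveDecay

variable {K κ lam : ℝ} {ι : Type} [DecidableEq ι] {p : ℕ} {e : ι → ℤ}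
  {A D : HpI ι p →L[ℝ] HpI ι p}

theorem mul_norm_le (h : CoerciveDecay K κ lam e A D) (v : HpI ι p) :
    lam * ‖v‖ ≤ ‖A v‖ := by
  rcases (norm_nonneg v).eq_or_lt with hv | hv
  · rw [← hv, mul_zero]; exact norm_nonneg _
  · have h1 := (h.coercive v).trans (real_inner_le_norm _ _)
    refine le_of_mul_le_mul_left ?_ hv
    linarith [h1, show lam * ‖v‖ ^ 2 = ‖v‖ * (lam * ‖v‖) by ring]

theorem norm_apply_le (h : CoerciveDecay K κ lam e A D) (hκ : 1 < κ) (hK : 0 < K)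
    (v : HpI ι p) : ‖A v‖ ≤ K * guSum κ * ‖v‖ := by
  obtain ⟨u, hu, hun⟩ := HpI.exists_kernel_apply h.inj hκ hK (blkCLM A) h.decay v
  have : A v = u := by
    ext1; funext i
    exact (hasSum_blkCLM A v i).unique (hu i)
  rwa [this]

/-- The column `k` of `D` solves `A w = 0` away from `k`. -/
theorem apply_column (h : CoerciveDecay K κ lam e A D) (k : ι) (a : EuclideanSpace ℝ (Fin p))
    {i : ι} (hik : i ≠ k) : A (D (lp.single 2 k a)) i = 0 := by
  rw [h.right_inv, lp.single_apply_ne _ _ _ hik]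

theorem norm_column_le (h : CoerciveDecay K κ lam e A D) (hlam : 0 < lam) (k : ι)
    (a : EuclideanSpace ℝ (Fin p)) : ‖D (lp.single 2 k a)‖ ≤ ‖a‖ / lam := by
  rw [le_div_iff₀ hlam, mul_comm]
  refine (h.mul_norm_le _).trans ?_
  rw [h.right_inv, lp.norm_single (by norm_num)]

end CoerciveDecay

/-- The distance to `e k`, truncated at height `n`. -/
def truncDist {ι : Type} (e : ι → ℤ) (k : ι) (n : ℝ) (i : ι) : ℝ := min |(e i : ℝ) - e k| n

section TruncDist

variable {ι : Type} {e : ι → ℤ}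

theorem abs_truncDist_le (k : ι) {n : ℝ} (hn : 0 ≤ n) (i : ι) : |truncDist e k n i| ≤ n := by
  rw [truncDist, abs_of_nonneg (le_min (abs_nonneg _) hn)]
  exact min_le_right _ _

theorem truncDist_self (k : ι) {n : ℝ} (hn : 0 ≤ n) : truncDist e k n k = 0 := by
  simp [truncDist, hn]

theorem abs_truncDist_sub_le (k : ι) (n : ℝ) (i l : ι) :
    |truncDist e k n l - truncDist e k n i| ≤ |(e i : ℝ) - e l| := by
  refine (abs_min_sub_min_le_max _ _ _ _).trans ?_
  rw [sub_self, abs_zero, max_eq_left (abs_nonneg _)]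
  refine (abs_abs_sub_abs_le _ _).trans (le_of_eq ?_)
  rw [sub_sub_sub_cancel_right, abs_sub_comm]

theorem truncDist_eq (k i : ι) :
    truncDist e k |(e i : ℝ) - e k| i = |(e i : ℝ) - e k| := min_self _

end TruncDist

namespace CoerciveDecay

variable {K κ lam : ℝ} {ι : Type} [DecidableEq ι] {p : ℕ} {e : ι → ℤ}
  {A D : HpI ι p →L[ℝ] HpI ι p}

theorem norm_commutator_le (h : CoerciveDecay K κ lam e A D) (hK : 0 ≤ K) (k : ι) (n : ℝ)
    (i l : ι) :
    ‖(truncDist e k n l - truncDist e k n i) • blkCLM A i l‖ ≤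
      K * gu ((e i : ℝ) - e l) ^ (-(κ - 1)) := by
  rw [norm_smul, Real.norm_eq_abs]
  calc _ ≤ |(e i : ℝ) - e l| * (K * gu ((e i : ℝ) - e l) ^ (-κ)) :=
        mul_le_mul (abs_truncDist_sub_le k n i l) (h.decay i l) (norm_nonneg _) (abs_nonneg _)
    _ = K * (|(e i : ℝ) - e l| * gu ((e i : ℝ) - e l) ^ (-κ)) := by ring
    _ ≤ _ := mul_le_mul_of_nonneg_left (abs_mul_gu_rpow_le _ _) hK

theorem norm_double_commutator_le (h : CoerciveDecay K κ lam e A D) (hK : 0 ≤ K) (k : ι) (n : ℝ)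
    (i l : ι) :
    ‖(truncDist e k n l - truncDist e k n i) ^ 2 • blkCLM A i l‖ ≤
      K * gu ((e i : ℝ) - e l) ^ (-(κ - 2)) := by
  rw [pow_two, mul_smul, norm_smul, Real.norm_eq_abs]
  calc _ ≤ |(e i : ℝ) - e l| * (K * gu ((e i : ℝ) - e l) ^ (-(κ - 1))) :=
        mul_le_mul (abs_truncDist_sub_le k n i l) (h.norm_commutator_le hK k n i l)
          (norm_nonneg _) (abs_nonneg _)
    _ = K * (|(e i : ℝ) - e l| * gu ((e i : ℝ) - e l) ^ (-(κ - 1))) := by ring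
    _ ≤ _ := by
      have := abs_mul_gu_rpow_le ((e i : ℝ) - e l) (κ - 1)
      rw [sub_sub, one_add_one_eq_two] at this
      exact mul_le_mul_of_nonneg_left this hK

/-- Multiplying a column of the inverse by the truncated distance and applying `A` only involves
the commutator of `A` with the multiplication. -/
theorem hasSum_commutator (h : CoerciveDecay K κ lam e A D) {k : ι} {n : ℝ} (hn : 0 ≤ n)
    {a : EuclideanSpace ℝ (Fin p)} {y : HpI ι p}
    (hy : ∀ i, y i = truncDist e k n i • D (lp.single 2 k a) i) (i : ι) :
    HasSum (fun l => ((truncDist e k n l - truncDist e k n i) • blkCLM A i l)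
      (D (lp.single 2 k a) l)) (A y i) := by
  have h1 := hasSum_blkCLM A y i
  have h2 := (hasSum_blkCLM A (D (lp.single 2 k a)) i).const_smul (truncDist e k n i)
  have h3 : truncDist e k n i • A (D (lp.single 2 k a)) i = 0 := by
    by_cases hik : i = k
    · rw [hik, truncDist_self k hn, zero_smul]
    · rw [h.apply_column k a hik, smul_zero]
  rw [h3] at h2
  convert h1.sub h2 using 1
  · funext l
    simp [hy, sub_smul]
  · simp

theorem norm_mul_column_le (h : CoerciveDecay K κ lam e A D) (hκ : 3 < κ) (hK : 0 < K)
    (hlam : 0 < lam) {k : ι} {n : ℝ} (hn : 0 ≤ n) {a : EuclideanSpace ℝ (Fin p)} {y : HpI ι p}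
    (hy : ∀ i, y i = truncDist e k n i • D (lp.single 2 k a) i) :
    ‖y‖ ≤ K * guSum (κ - 1) * (‖a‖ / lam) / lam := by
  obtain ⟨u, hu, hun⟩ := HpI.exists_kernel_apply h.inj (by linarith) hK
    (fun i l => (truncDist e k n l - truncDist e k n i) • blkCLM A i l)
    (h.norm_commutator_le hK.le k n) (D (lp.single 2 k a))
  have hA : A y = u := by
    ext1; funext i
    exact (h.hasSum_commutator hn hy i).unique (hu i)
  rw [le_div_iff₀ hlam, mul_comm]
  refine ((h.mul_norm_le y).trans (hA ▸ hun)).trans ?_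
  exact mul_le_mul_of_nonneg_left (h.norm_column_le hlam k a)
    (mul_nonneg hK.le (guSum_pos (by linarith)).le)

theorem norm_sq_mul_column_le (h : CoerciveDecay K κ lam e A D) (hκ : 3 < κ) (hK : 0 < K)
    (hlam : 0 < lam) {k : ι} {n : ℝ} (hn : 0 ≤ n) {a : EuclideanSpace ℝ (Fin p)} {z : HpI ι p}
    (hz : ∀ i, z i = truncDist e k n i ^ 2 • D (lp.single 2 k a) i) :
    ‖z‖ ≤ (2 * (K * guSum (κ - 1)) * (K * guSum (κ - 1) * (‖a‖ / lam) / lam) +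
      K * guSum (κ - 2) * (‖a‖ / lam)) / lam := by
  set w := D (lp.single 2 k a) with hw
  set x := truncDist e k n with hx
  obtain ⟨y, hy⟩ := HpI.exists_mul w (abs_truncDist_le (e := e) k hn)
  obtain ⟨u, hu, hun⟩ := HpI.exists_kernel_apply h.inj (by linarith) hK
    (fun i l => (x l - x i) • blkCLM A i l) (h.norm_commutator_le hK.le k n) y
  obtain ⟨u', hu', hun'⟩ := HpI.exists_kernel_apply h.inj (by linarith) hK
    (fun i l => (x l - x i) ^ 2 • blkCLM A i l) (h.norm_double_commutator_le hK.le k n) w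
  have hA : A z = (2 : ℝ) • u - u' := by
    ext1; funext i
    have h1 := hasSum_blkCLM A z i
    have h2 := (hasSum_blkCLM A w i).const_smul (x i ^ 2)
    have h3 : x i ^ 2 • A w i = 0 := by
      by_cases hik : i = k
      · rw [hik, hx, truncDist_self k hn]; simp
      · rw [hw, h.apply_column k a hik, smul_zero]
    have h4 := (h1.sub h2).unique (f := fun l => blkCLM A i l (z l) - x i ^ 2 • blkCLM A i l (w l))
      (by
        convert ((hu i).const_smul (2 : ℝ)).sub (hu' i) using 1
        funext l
        simp only [hz, hy, map_smul, smul_apply, smul_smul, ← sub_smul]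
        congr 1
        ring)
    rw [h3, sub_zero] at h4
    exact h4
  rw [le_div_iff₀ hlam, mul_comm]
  refine (h.mul_norm_le z).trans ?_
  rw [hA]
  refine (norm_sub_le _ _).trans ?_
  rw [norm_smul, Real.norm_eq_abs, abs_two]
  have hy' := h.norm_mul_column_le hκ hK hlam hn hy
  have hw' := h.norm_column_le hlam k a
  have hG1 : 0 ≤ K * guSum (κ - 1) := mul_nonneg hK.le (guSum_pos (by linarith)).le
  have hG2 : 0 ≤ K * guSum (κ - 2) := mul_nonneg hK.le (guSum_pos (by linarith)).le
  have e1 := hun.trans (mul_le_mul_of_nonneg_left hy' hG1)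
  have e2 := hun'.trans (mul_le_mul_of_nonneg_left hw' hG2)
  linarith

end CoerciveDecay

theorem inverseDecay_two {K κ lam : ℝ} (hκ : 3 < κ) (hK : 0 < K) (hlam : 0 < lam) :
    InverseDecay K κ lam 2 := by
  have hG1 : 0 < K * guSum (κ - 1) := mul_pos hK (guSum_pos (by linarith))
  have hG2 : 0 < K * guSum (κ - 2) := mul_pos hK (guSum_pos (by linarith))
  set c := 1 / lam + (2 * (K * guSum (κ - 1)) * (K * guSum (κ - 1) * (1 / lam) / lam) +
      K * guSum (κ - 2) * (1 / lam)) / lam with hc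
  refine ⟨c, by positivity, fun ι _ p e A D h i k => ?_⟩
  refine ContinuousLinearMap.opNorm_le_bound _
    (mul_nonneg (by positivity) (gu_rpow_pos _ _).le) (fun a => ?_)
  rw [blkCLM_apply]
  set r := |(e i : ℝ) - e k| with hr
  have hr0 : 0 ≤ r := abs_nonneg _
  obtain ⟨z, hz⟩ := HpI.exists_mul (D (lp.single 2 k a)) (x := fun i => truncDist e k r i ^ 2)
    (B := r ^ 2) (fun i => by
      rw [abs_pow]; exact pow_le_pow_left₀ (abs_nonneg _) (abs_truncDist_le k hr0 i) 2)
  have h1 := (HpI.norm_apply_le z i).trans (h.norm_sq_mul_column_le hκ hK hlam hr0 hz)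
  rw [hz i, truncDist_eq, norm_smul, Real.norm_eq_abs, abs_of_nonneg (by positivity)] at h1
  have h2 := (HpI.norm_apply_le _ i).trans (h.norm_column_le hlam k a)
  have h3 : gu ((e i : ℝ) - e k) ^ 2 * ‖D (lp.single 2 k a) i‖ ≤ c * ‖a‖ := by
    have hle : gu ((e i : ℝ) - e k) ^ 2 ≤ 1 + r ^ 2 := by
      rw [gu]
      rcases max_cases 1 |(e i : ℝ) - e k| with ⟨hm, -⟩ | ⟨hm, -⟩ <;> rw [hm] <;> nlinarith
    calc _ ≤ (1 + r ^ 2) * ‖D (lp.single 2 k a) i‖ :=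
          mul_le_mul_of_nonneg_right hle (norm_nonneg _)
      _ = ‖D (lp.single 2 k a) i‖ + r ^ 2 * ‖D (lp.single 2 k a) i‖ := by ring
      _ ≤ _ := add_le_add h2 h1
      _ = c * ‖a‖ := by rw [hc]; ring
  rw [Real.rpow_neg (gu_pos _).le, Real.rpow_two]
  have hg : 0 < gu ((e i : ℝ) - e k) ^ 2 := pow_pos (gu_pos _) 2
  rw [mul_right_comm, ← div_eq_mul_inv, le_div_iff₀ hg]
  linarith

/-- Bootstrap: each application of the commutator identity gains one power of decay. -/
theorem InverseDecay.add_one {K κ lam s : ℝ} (hK : 0 < K) (h : InverseDecay K κ lam s)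
    (hs : 1 < s) (hsκ : s ≤ κ - 1) : InverseDecay K κ lam (s + 1) := by
  obtain ⟨c, hc, hD⟩ := h
  set c' := c + c * (K * c * convConst s) * convConst s with hc'
  have hconv := convConst_pos hs
  refine ⟨c', by positivity, fun ι _ p e A D h i k => ?_⟩
  refine ContinuousLinearMap.opNorm_le_bound _
    (mul_nonneg (by positivity) (gu_rpow_pos _ _).le) (fun a => ?_)
  rw [blkCLM_apply]
  set w := D (lp.single 2 k a) with hw
  set r := |(e i : ℝ) - e k| with hr
  have hr0 : 0 ≤ r := abs_nonneg _
  have hwl : ∀ l, ‖w l‖ ≤ c * gu ((e l : ℝ) - e k) ^ (-s) * ‖a‖ := fun l => by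
    rw [hw, ← blkCLM_apply]
    exact (blkCLM D l k).le_of_opNorm_le (hD ι p e A D h l k) a
  obtain ⟨y, hy⟩ := HpI.exists_mul w (abs_truncDist_le (e := e) k hr0)
  have hAy : ∀ l, ‖A y l‖ ≤ (K * (c * ‖a‖)) * convConst s * gu ((e l : ℝ) - e k) ^ (-s) := by
    intro l
    refine norm_le_of_hasSum_conv h.inj hs (by positivity) (h.hasSum_commutator hr0 hy l) _ _
      (fun m => ?_)
    have h1 := (h.norm_commutator_le hK.le k r l m).trans
      (mul_le_mul_of_nonneg_left (gu_rpow_anti _ hsκ) hK.le)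
    calc _ ≤ _ := ContinuousLinearMap.le_of_opNorm_le _ h1 _
      _ ≤ _ := mul_le_mul_of_nonneg_left (hwl m) (mul_nonneg hK.le (gu_rpow_pos _ _).le)
      _ = _ := by ring
  have hyi : ‖y i‖ ≤ (c * ((K * (c * ‖a‖)) * convConst s)) * convConst s *
      gu ((e i : ℝ) - e k) ^ (-s) := by
    have h1 := hasSum_blkCLM D (A y) i
    rw [h.left_inv] at h1
    refine norm_le_of_hasSum_conv h.inj hs (by positivity) h1 _ _ (fun l => ?_)
    calc _ ≤ _ := ContinuousLinearMap.le_of_opNorm_le _ (hD ι p e A D h i l) _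
      _ ≤ _ := mul_le_mul_of_nonneg_left (hAy l) (mul_nonneg hc.le (gu_rpow_pos _ _).le)
      _ = _ := by ring
  rw [hy i, truncDist_eq, norm_smul, Real.norm_eq_abs, abs_abs] at hyi
  have h3 : gu ((e i : ℝ) - e k) * ‖w i‖ ≤ c' * ‖a‖ * gu ((e i : ℝ) - e k) ^ (-s) := by
    have hle : gu ((e i : ℝ) - e k) ≤ 1 + r := max_le (by linarith) (by linarith)
    calc _ ≤ (1 + r) * ‖w i‖ := mul_le_mul_of_nonneg_right hle (norm_nonneg _)
      _ = ‖w i‖ + r * ‖w i‖ := by ring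
      _ ≤ _ := add_le_add (hwl i) hyi
      _ = _ := by rw [hc']; ring
  rw [neg_add, Real.rpow_add (gu_pos _), Real.rpow_neg_one]
  have hg := gu_pos ((e i : ℝ) - e k)
  rw [mul_right_comm, ← mul_assoc, ← div_eq_mul_inv, le_div_iff₀ hg]
  linarith

/-- Polynomial decay of the inverse, at the order needed for the VAR coefficients. -/
theorem inverseDecay_sub_one {K κ lam : ℝ} (hκ : 3 < κ) (hK : 0 < K) (hlam : 0 < lam) :
    InverseDecay K κ lam (κ - 1) := by
  have key : ∀ n : ℕ, ∀ s : ℝ, 1 < s → s ≤ n + 2 → s ≤ κ - 1 → InverseDecay K κ lam s := by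
    intro n
    induction n with
    | zero => exact fun s _ hs2 _ => (inverseDecay_two hκ hK hlam).mono (by simpa using hs2)
    | succ n ih =>
      intro s hs hs2 hsκ
      push_cast at hs2
      by_cases h2 : s ≤ 2
      · exact (inverseDecay_two hκ hK hlam).mono h2
      · have := (ih (s - 1) (by linarith) (by linarith) (by linarith)).add_one hK (by linarith)
          (by linarith)
        rwa [sub_add_cancel] at this
  obtain ⟨n, hn⟩ := exists_nat_ge κ
  exact key n _ (by linarith) (by linarith) le_rfl

/-- A matrix kernel on `ℤ × ℤ` whose finite sections are bounded below by `lam`. -/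
def KernelCoercive {p : ℕ} (lam : ℝ) (k : ℤ → ℤ → Matrix (Fin p) (Fin p) ℝ) : Prop :=
  ∀ (S : Finset ℤ) (v : ℤ → EuclideanSpace ℝ (Fin p)), lam * ∑ t ∈ S, ‖v t‖ ^ 2 ≤
    ∑ t ∈ S, ∑ τ ∈ S, inner ℝ (v t) (Matrix.toEuclideanCLM (𝕜 := ℝ) (k t τ) (v τ))

section Coercivity

variable {ι : Type} [DecidableEq ι] {p : ℕ}

theorem inner_sum_single_apply (A : HpI ι p →L[ℝ] HpI ι p) (S : Finset ι)
    (v : ι → EuclideanSpace ℝ (Fin p)) :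
    inner ℝ (∑ i ∈ S, lp.single 2 i (v i) : HpI ι p) (A (∑ i ∈ S, lp.single 2 i (v i))) =
      ∑ i ∈ S, ∑ l ∈ S, inner ℝ (v i) (blkCLM A i l (v l)) := by
  rw [map_sum, sum_inner]
  refine Finset.sum_congr rfl fun i _ => ?_
  rw [inner_sum]
  refine Finset.sum_congr rfl fun l _ => ?_
  rw [lp.inner_single_left, blkCLM_apply]

theorem norm_sq_sum_single (S : Finset ι) (v : ι → EuclideanSpace ℝ (Fin p)) :
    ‖(∑ i ∈ S, lp.single 2 i (v i) : HpI ι p)‖ ^ 2 = ∑ i ∈ S, ‖v i‖ ^ 2 := by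
  have := lp.norm_sum_single (p := 2) (by norm_num) v S
  simpa using this

theorem kernelCoercive_of_coercive {lam : ℝ} {A : Hp p →L[ℝ] Hp p}
    (h : ∀ v, lam * ‖v‖ ^ 2 ≤ inner ℝ v (A v)) : KernelCoercive lam (blk A) := by
  intro S v
  have := h (∑ i ∈ S, lp.single 2 i (v i))
  rwa [inner_sum_single_apply, norm_sq_sum_single] at this

theorem KernelCoercive.translate {lam : ℝ} {k : ℤ → ℤ → Matrix (Fin p) (Fin p) ℝ}
    (h : KernelCoercive lam k) (m : ℤ) : KernelCoercive lam fun t τ => k (t + m) (τ + m) := by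
  intro S v
  simpa using h (S.map (addRightEmbedding m)) (fun t => v (t - m))

theorem KernelCoercive.coercive {lam : ℝ} {k : ℤ → ℤ → Matrix (Fin p) (Fin p) ℝ}
    (h : KernelCoercive lam k) {e : ι → ℤ} (he : Function.Injective e)
    {A : HpI ι p →L[ℝ] HpI ι p} (hA : ∀ i l, blk A i l = k (e i) (e l)) (v : HpI ι p) :
    lam * ‖v‖ ^ 2 ≤ inner ℝ v (A v) := by
  have hv : Filter.Tendsto (fun S : Finset ι => (∑ i ∈ S, lp.single 2 i (v i) : HpI ι p))
      Filter.atTop (nhds v) := lp.hasSum_single (by norm_num) v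
  have h1 : Continuous fun v : HpI ι p => lam * ‖v‖ ^ 2 := by fun_prop
  have h2 : Continuous fun v : HpI ι p => inner ℝ v (A v) := by fun_prop
  refine le_of_tendsto_of_tendsto' ((h1.tendsto v).comp hv) ((h2.tendsto v).comp hv) fun S => ?_
  simp only [Function.comp_def]
  rw [inner_sum_single_apply, norm_sq_sum_single]
  have := h (S.map ⟨e, he⟩) (Function.extend e v 0)
  simpa [he.extend_apply, blkCLM, hA] using this

theorem KernelCoercive.of_tendsto {lam : ℝ} {k : ℕ → ℤ → ℤ → Matrix (Fin p) (Fin p) ℝ}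
    {k' : ℤ → ℤ → Matrix (Fin p) (Fin p) ℝ} (h : ∀ m, KernelCoercive lam (k m))
    (hk : ∀ t τ, Filter.Tendsto (fun m => specNorm (k m t τ - k' t τ)) Filter.atTop (nhds 0)) :
    KernelCoercive lam k' := by
  intro S v
  refine ge_of_tendsto' (x := Filter.atTop) (tendsto_finsetSum _ fun t _ => tendsto_finsetSum _ fun τ _ => ?_)
    (fun m => h m S v)
  have h1 : Filter.Tendsto (fun m => Matrix.toEuclideanCLM (𝕜 := ℝ) (k m t τ)) Filter.atTop
      (nhds (Matrix.toEuclideanCLM (𝕜 := ℝ) (k' t τ))) := by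
    rw [tendsto_iff_norm_sub_tendsto_zero]
    simpa only [← map_sub, norm_toEuclideanCLM_eq_specNorm] using hk t τ
  exact tendsto_const_nhds.inner
    (((ContinuousLinearMap.apply ℝ _ (v τ)).continuous.tendsto _).comp h1)

end Coercivity

theorem specNorm_nonneg {p : ℕ} (M : Matrix (Fin p) (Fin p) ℝ) : 0 ≤ specNorm M := norm_nonneg _

theorem specNorm_add_le {p : ℕ} (M M' : Matrix (Fin p) (Fin p) ℝ) :
    specNorm (M + M') ≤ specNorm M + specNorm M' := by
  simp only [← norm_toEuclideanCLM_eq_specNorm, map_add]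
  exact norm_add_le _ _

theorem specNorm_mul_le {p : ℕ} (M M' : Matrix (Fin p) (Fin p) ℝ) :
    specNorm (M * M') ≤ specNorm M * specNorm M' := by
  simp only [← norm_toEuclideanCLM_eq_specNorm, map_mul]
  exact norm_mul_le _ _

theorem specNorm_neg {p : ℕ} (M : Matrix (Fin p) (Fin p) ℝ) : specNorm (-M) = specNorm M := by
  simp only [← norm_toEuclideanCLM_eq_specNorm, map_neg, norm_neg]

theorem specNorm_sub_comm {p : ℕ} (M M' : Matrix (Fin p) (Fin p) ℝ) :
    specNorm (M - M') = specNorm (M' - M) := by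
  rw [← specNorm_neg, neg_sub]

theorem specNorm_sub_le {p : ℕ} (M M' : Matrix (Fin p) (Fin p) ℝ) :
    specNorm (M - M') ≤ specNorm M + specNorm M' := by
  rw [sub_eq_add_neg, ← specNorm_neg M']
  exact specNorm_add_le _ _

namespace AssumptionLS

variable {p : ℕ} {K κ lamInf lamSup : ℝ} {N₀ : ℕ} {C : ℕ → Hp p →L[ℝ] Hp p}
  {Cr : ℤ → ℝ → Matrix (Fin p) (Fin p) ℝ}

theorem K_nonneg (h : AssumptionLS p K κ lamInf lamSup N₀ C Cr) : 0 ≤ K := by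
  have h1 := (specNorm_nonneg _).trans (h.crBound 0 0)
  exact nonneg_of_mul_nonneg_left h1 (gu_rpow_pos _ _)

/-- The local approximation with the rescaled time frozen at `u`. -/
theorem specNorm_blk_sub_le (h : AssumptionLS p K κ lamInf lamSup N₀ C Cr) {N : ℕ} (hN : 1 ≤ N)
    (t τ : ℤ) (u : ℝ) :
    specNorm (blk (C N) t τ - Cr (t - τ) u) ≤
      K * gu ((t : ℝ) - τ) ^ (-(κ - 1)) * (1 / N + |(t : ℝ) / N - u|) := by
  have h1 := h.approx N hN t τ
  have h2 := h.crLip (t - τ) ((t : ℝ) / N) u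
  have hK := h.K_nonneg
  have hg := (gu_rpow_pos ((t : ℝ) - τ) (-(κ - 1))).le
  rw [show -κ + 1 = -(κ - 1) by ring] at h1
  rw [Int.cast_sub] at h2
  rw [← sub_add_sub_cancel _ (Cr (t - τ) ((t : ℝ) / N)) _, mul_add]
  refine (specNorm_add_le _ _).trans (add_le_add (h1.trans ?_) (h2.trans ?_))
  · exact mul_le_mul_of_nonneg_left (min_le_left _ _) (mul_nonneg hK hg)
  · rw [mul_right_comm]
    exact mul_le_mul_of_nonneg_right (mul_le_mul_of_nonneg_left
      (gu_rpow_anti _ (by linarith)) hK) (abs_nonneg _)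

theorem kernelCoercive_stationary (h : AssumptionLS p K κ lamInf lamSup N₀ C Cr) {N : ℕ}
    (hN : N₀ ≤ N) (hN1 : 1 ≤ N) (T : ℤ) :
    KernelCoercive lamInf fun t τ => Cr (t - τ) ((T : ℝ) / N) := by
  have hpos : (0 : ℝ) < N := by exact_mod_cast hN1
  refine KernelCoercive.of_tendsto
    (k := fun m t τ => blk (C (N * (m + 1))) (t + T * (m + 1)) (τ + T * (m + 1)))
    (fun m => (kernelCoercive_of_coercive
      (h.lower _ (hN.trans (Nat.le_mul_of_pos_right N m.succ_pos)))).translate _) (fun t τ => ?_)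
  have hlim : Filter.Tendsto (fun m : ℕ => K * gu ((t : ℝ) - τ) ^ (-(κ - 1)) *
      ((1 + |(t : ℝ)|) / N * (1 / ((m : ℝ) + 1)))) Filter.atTop (nhds 0) := by
    simpa using (tendsto_one_div_add_atTop_nhds_zero_nat (𝕜 := ℝ)).const_mul
      ((1 + |(t : ℝ)|) / N) |>.const_mul (K * gu ((t : ℝ) - τ) ^ (-(κ - 1)))
  refine squeeze_zero (fun _ => specNorm_nonneg _) (fun m => ?_) hlim
  have h1 := h.specNorm_blk_sub_le (N := N * (m + 1))
    (hN1.trans (Nat.le_mul_of_pos_right N m.succ_pos))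
    (t + T * (m + 1)) (τ + T * (m + 1)) ((T : ℝ) / N)
  rw [add_sub_add_right_eq_sub] at h1
  refine h1.trans (le_of_eq ?_)
  have hm : (0 : ℝ) < (m : ℝ) + 1 := by positivity
  push_cast
  rw [add_sub_add_right_eq_sub,
    show ((t : ℝ) + T * (m + 1)) / (N * (m + 1)) - T / N = t / (N * (m + 1)) by field_simp; ring,
    abs_div, abs_of_pos (mul_pos hpos hm)]
  field_simp

end AssumptionLS

section Comparison

variable {K κ lam : ℝ} {ι ι' : Type} [DecidableEq ι] [DecidableEq ι'] {p : ℕ} {e : ι → ℤ}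
  {e' : ι' → ℤ} {A D : HpI ι p →L[ℝ] HpI ι p} {B F : HpI ι' p →L[ℝ] HpI ι' p}

/-- Resolvent comparison: if the blocks of `A` and `B` differ by `δ` times a weight growing linearly
in the distance to the index `i₀`, then the rows at `i₀` of the inverses differ by `O(δ)`. -/
theorem CoerciveDecay.norm_blkCLM_sub_le (hA : CoerciveDecay K κ lam e A D)
    (hB : CoerciveDecay K κ lam e' B F) (hκ : 3 < κ) {c δ : ℝ} (hc : 0 < c) (hδ : 0 ≤ δ)
    (hD : ∀ i k, ‖blkCLM D i k‖ ≤ c * gu ((e i : ℝ) - e k) ^ (-(κ - 1)))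
    (hF : ∀ i k, ‖blkCLM F i k‖ ≤ c * gu ((e' i : ℝ) - e' k) ^ (-(κ - 1)))
    (σ : ι ≃ ι') (hσ : ∀ i l, e' (σ i) - e' (σ l) = e i - e l) (i₀ : ι)
    (hAB : ∀ i l, ‖blkCLM B (σ i) (σ l) - blkCLM A i l‖ ≤
      δ * (gu ((e i₀ : ℝ) - e i) * gu ((e i : ℝ) - e l) ^ (-(κ - 1)))) (k : ι) :
    ‖blkCLM D i₀ k - blkCLM F (σ i₀) (σ k)‖ ≤
      c * (c * convConst (κ - 1)) * convConst (κ - 2) * δ *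
        gu ((e i₀ : ℝ) - e k) ^ (-(κ - 2)) := by
  have hσ' : ∀ i l, (e' (σ i) : ℝ) - e' (σ l) = e i - e l := fun i l => by exact_mod_cast hσ i l
  have hc1 := convConst_pos (show 1 < κ - 1 by linarith)
  have hc2 := convConst_pos (show 1 < κ - 2 by linarith)
  refine ContinuousLinearMap.opNorm_le_bound _
    (mul_nonneg (by positivity) (gu_rpow_pos _ _).le) (fun a => ?_)
  set w' := F (lp.single 2 (σ k) a) with hw'
  obtain ⟨w, hw⟩ := HpI.exists_of_summable (f := fun i => w' (σ i))
    ((HpI.summable_norm_sq w').comp_injective σ.injective)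
  have hwl : ∀ l, ‖w l‖ ≤ c * gu ((e l : ℝ) - e k) ^ (-(κ - 1)) * ‖a‖ := fun l => by
    rw [hw, hw', ← blkCLM_apply, ← hσ']
    exact (blkCLM F _ _).le_of_opNorm_le (hF _ _) a
  set h : HpI ι p := lp.single 2 k a - A w with hh
  have hsum : ∀ i, HasSum (fun l => (blkCLM B (σ i) (σ l) - blkCLM A i l) (w l)) (h i) := by
    intro i
    have h1 := hasSum_blkCLM A w i
    have h2 := (σ.hasSum_iff).mpr (hasSum_blkCLM B w' (σ i))
    rw [hw', hB.right_inv] at h2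
    have h3 : (lp.single 2 (σ k) a : HpI ι' p) (σ i) = (lp.single 2 k a : HpI ι p) i := by
      by_cases hik : i = k
      · rw [hik, lp.single_apply_self, lp.single_apply_self]
      · rw [lp.single_apply_ne _ _ _ hik, lp.single_apply_ne _ _ _ (σ.injective.ne hik)]
    rw [h3] at h2
    convert h2.sub h1 using 1
    · funext l
      simp [hw, hw']
    · rw [hh]; rfl
  have hhi : ∀ i, ‖h i‖ ≤ δ * gu ((e i₀ : ℝ) - e i) * (c * ‖a‖) * convConst (κ - 1) *
      gu ((e i : ℝ) - e k) ^ (-(κ - 1)) := by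
    intro i
    have hg := (gu_pos ((e i₀ : ℝ) - e i)).le
    refine norm_le_of_hasSum_conv hA.inj (by linarith) (by positivity) (hsum i) _ _ (fun l => ?_)
    calc _ ≤ _ := ContinuousLinearMap.le_of_opNorm_le _ (hAB i l) _
      _ ≤ _ := mul_le_mul_of_nonneg_left (hwl l)
        (mul_nonneg hδ (mul_nonneg hg (gu_rpow_pos _ _).le))
      _ = _ := by ring
  have hrep : (blkCLM D i₀ k - blkCLM F (σ i₀) (σ k)) a = D h i₀ := by
    rw [hh, map_sub, hA.left_inv]
    simp [blkCLM_apply, hw, hw']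
  rw [hrep]
  refine (norm_le_of_hasSum_conv (c := c * (δ * (c * ‖a‖) * convConst (κ - 1))) hA.inj
    (show 1 < κ - 2 by linarith) (by positivity) (hasSum_blkCLM D h i₀) _ (e k)
    (fun i => ?_)).trans (le_of_eq (by ring))
  have h1 : gu ((e i₀ : ℝ) - e i) ^ (-(κ - 1)) * gu ((e i₀ : ℝ) - e i) =
      gu ((e i₀ : ℝ) - e i) ^ (-(κ - 2)) := by
    rw [← Real.rpow_add_one (gu_pos _).ne']
    ring_nf
  have h2 := gu_rpow_anti ((e i : ℝ) - e k) (show κ - 2 ≤ κ - 1 by linarith)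
  calc _ ≤ _ := ContinuousLinearMap.le_of_opNorm_le _ (hD i₀ i) _
    _ ≤ _ := mul_le_mul_of_nonneg_left (hhi i) (mul_nonneg hc.le (gu_rpow_pos _ _).le)
    _ = c * (δ * (c * ‖a‖) * convConst (κ - 1)) * ((gu ((e i₀ : ℝ) - e i) ^ (-(κ - 1)) *
        gu ((e i₀ : ℝ) - e i)) * gu ((e i : ℝ) - e k) ^ (-(κ - 1))) := by ring
    _ ≤ _ := by
      rw [h1]
      exact mul_le_mul_of_nonneg_left (mul_le_mul_of_nonneg_left h2 (gu_rpow_pos _ _).le)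
        (by positivity)

end Comparison

theorem Matrix.inv_of_coercive {p : ℕ} {M : Matrix (Fin p) (Fin p) ℝ} {μ : ℝ} (hμ : 0 < μ)
    (h : ∀ a, μ * ‖a‖ ^ 2 ≤ inner ℝ a (Matrix.toEuclideanCLM (𝕜 := ℝ) M a)) :
    IsUnit M ∧ specNorm M⁻¹ ≤ μ⁻¹ := by
  have hle : ∀ a, μ * ‖a‖ ≤ ‖Matrix.toEuclideanCLM (𝕜 := ℝ) M a‖ := fun a => by
    rcases (norm_nonneg a).eq_or_lt with ha | ha
    · rw [← ha, mul_zero]; exact norm_nonneg _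
    · have h1 := (h a).trans (real_inner_le_norm _ _)
      refine le_of_mul_le_mul_left ?_ ha
      linarith [h1, show μ * ‖a‖ ^ 2 = ‖a‖ * (μ * ‖a‖) by ring]
  have hinj : Function.Injective (Matrix.toEuclideanCLM (𝕜 := ℝ) M) := by
    refine (injective_iff_map_eq_zero _).mpr fun a ha => ?_
    have h1 := hle a
    rw [ha, norm_zero] at h1
    exact norm_le_zero_iff.mp (nonpos_of_mul_nonpos_right h1 hμ)
  have hu : IsUnit M := by
    rw [← Matrix.mulVec_injective_iff_isUnit]
    intro x y hxy
    have := @hinj (WithLp.toLp 2 x) (WithLp.toLp 2 y) (by simp [hxy])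
    exact congrArg WithLp.ofLp this
  refine ⟨hu, ?_⟩
  rw [← norm_toEuclideanCLM_eq_specNorm]
  refine ContinuousLinearMap.opNorm_le_bound _ (by positivity) fun b => ?_
  have h1 := hle (Matrix.toEuclideanCLM (𝕜 := ℝ) M⁻¹ b)
  rw [← mul_apply_eq_comp, ← map_mul,
    Matrix.mul_nonsing_inv _ ((Matrix.isUnit_iff_isUnit_det _).mp hu), map_one,
    one_apply_eq_self] at h1
  rwa [le_inv_mul_iff₀ hμ]

theorem CoerciveDecay.inv_blk_diag {K κ lam : ℝ} {ι : Type} [DecidableEq ι] {p : ℕ} {e : ι → ℤ}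
    {A D : HpI ι p →L[ℝ] HpI ι p} (h : CoerciveDecay K κ lam e A D) (hκ : 1 < κ) (hK : 0 < K)
    (hlam : 0 < lam) (i : ι) :
    IsUnit (blk D i i) ∧ specNorm (blk D i i)⁻¹ ≤ (lam / (K * guSum κ) ^ 2)⁻¹ := by
  have hG : 0 < K * guSum κ := mul_pos hK (guSum_pos hκ)
  refine Matrix.inv_of_coercive (by positivity) fun a => ?_
  set w := D (lp.single 2 i a) with hw
  have h1 : inner ℝ a (Matrix.toEuclideanCLM (𝕜 := ℝ) (blk D i i) a) = inner ℝ w (A w) := by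
    rw [hw, h.right_inv, lp.inner_single_right, real_inner_comm]
    exact congrArg (inner ℝ · a) (blkCLM_apply D i i a)
  have h2 : ‖a‖ ≤ K * guSum κ * ‖w‖ := by
    have := h.norm_apply_le hκ hK w
    rwa [hw, h.right_inv, lp.norm_single (by norm_num)] at this
  rw [h1]
  refine le_trans ?_ (h.coercive w)
  rw [div_mul_eq_mul_div, div_le_iff₀ (by positivity), mul_assoc]
  refine mul_le_mul_of_nonneg_left ?_ hlam.le
  rw [mul_comm, ← mul_pow]
  exact pow_le_pow_left₀ (norm_nonneg _) h2 2

theorem gu_le_zeta_inv (x : ℝ) : (gu x)⁻¹ ≤ zeta x := by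
  rw [zeta, inv_eq_one_div]
  exact div_le_div_of_nonneg_right (le_max_left _ _) (gu_pos x).le

theorem gu_rpow_neg_le_zeta_rpow (x : ℝ) {s : ℝ} (hs : 0 ≤ s) : gu x ^ (-s) ≤ zeta x ^ s := by
  rw [Real.rpow_neg (gu_pos x).le, ← Real.inv_rpow (gu_pos x).le]
  exact Real.rpow_le_rpow (inv_pos.mpr (gu_pos x)).le (gu_le_zeta_inv x) hs

theorem zeta_pos (x : ℝ) : 0 < zeta x := (inv_pos.mpr (gu_pos x)).trans_le (gu_le_zeta_inv x)

section VarParameters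

variable {p : ℕ} {X Y P Q : Matrix (Fin p) (Fin p) ℝ}

theorem specNorm_inv_sub_inv_le (hX : IsUnit X) (hY : IsUnit Y) {m d : ℝ}
    (hXm : specNorm X⁻¹ ≤ m) (hYm : specNorm Y⁻¹ ≤ m) (hd : specNorm (X - Y) ≤ d) :
    specNorm (X⁻¹ - Y⁻¹) ≤ m * d * m := by
  have hm : 0 ≤ m := (specNorm_nonneg _).trans hXm
  have hd0 : 0 ≤ d := (specNorm_nonneg _).trans hd
  have h : X⁻¹ - Y⁻¹ = X⁻¹ * (Y - X) * Y⁻¹ := by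
    rw [mul_sub, sub_mul, Matrix.nonsing_inv_mul _ ((Matrix.isUnit_iff_isUnit_det _).mp hX),
      one_mul, mul_assoc, Matrix.mul_nonsing_inv _ ((Matrix.isUnit_iff_isUnit_det _).mp hY),
      mul_one]
  rw [h]
  refine (specNorm_mul_le _ _).trans (mul_le_mul ((specNorm_mul_le _ _).trans
    (mul_le_mul hXm ?_ (specNorm_nonneg _) hm)) hYm (specNorm_nonneg _) (mul_nonneg hm hd0))
  rwa [specNorm_sub_comm]

theorem specNorm_neg_inv_mul_sub_le {m b d d' : ℝ} (hYm : specNorm Y⁻¹ ≤ m)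
    (hXY : specNorm (X⁻¹ - Y⁻¹) ≤ d) (hP : specNorm P ≤ b) (hPQ : specNorm (P - Q) ≤ d') :
    specNorm (-X⁻¹ * P - -Y⁻¹ * Q) ≤ d * b + m * d' := by
  have h : -X⁻¹ * P - -Y⁻¹ * Q = -((X⁻¹ - Y⁻¹) * P + Y⁻¹ * (P - Q)) := by noncomm_ring
  rw [h, specNorm_neg]
  refine (specNorm_add_le _ _).trans (add_le_add ?_ ?_)
  · exact (specNorm_mul_le _ _).trans
      (mul_le_mul hXY hP (specNorm_nonneg _) ((specNorm_nonneg _).trans hXY))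
  · exact (specNorm_mul_le _ _).trans
      (mul_le_mul hYm hPQ (specNorm_nonneg _) ((specNorm_nonneg _).trans hYm))

theorem specNorm_neg_inv_mul_sub_le_add {m b : ℝ} (hXm : specNorm X⁻¹ ≤ m)
    (hYm : specNorm Y⁻¹ ≤ m) (hP : specNorm P ≤ b) (hQ : specNorm Q ≤ b) :
    specNorm (-X⁻¹ * P - -Y⁻¹ * Q) ≤ m * b + m * b := by
  have hm : 0 ≤ m := (specNorm_nonneg _).trans hXm
  refine (specNorm_sub_le _ _).trans (add_le_add ?_ ?_)
  · exact (specNorm_mul_le _ _).trans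
      (mul_le_mul (by rwa [specNorm_neg]) hP (specNorm_nonneg _) hm)
  · exact (specNorm_mul_le _ _).trans
      (mul_le_mul (by rwa [specNorm_neg]) hQ (specNorm_nonneg _) hm)

end VarParameters

/-- Theorem 3.6(i): smooth approximation of the nonstationary VAR(∞) parameters
`Σ_T^(N) = ([𝐂^(N)(−∞,T)⁻¹]_{T,T})⁻¹` and
`Φ^(N)_{T,j} = −Σ_T^(N) [𝐂^(N)(−∞,T)⁻¹]_{T,T−j}` by the stationary parameters
`Σ(T/N)` and `Φ_j(T/N)` obtained from the inverse of the compression of the Toeplitz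
operator `𝐂(T/N)` to `ℓ²({t ≤ 0}; ℝ^p)`. -/
theorem var_parameters_local_approximation (K κ lamInf lamSup : ℝ) (N₀ : ℕ)
    (hκ : 3 < κ) (hInf : 0 < lamInf) (hle : lamInf ≤ lamSup) :
    ∃ 𝒦 : ℝ, 0 < 𝒦 ∧
      ∀ (p : ℕ), 1 ≤ p →
        ∀ (C : ℕ → Hp p →L[ℝ] Hp p) (Cr : ℤ → ℝ → Matrix (Fin p) (Fin p) ℝ),
          AssumptionLS p K κ lamInf lamSup N₀ C Cr →
          ∀ N : ℕ, N₀ ≤ N → 1 ≤ N → ∀ T : ℤ,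
            ∀ (CNT DNT : HpI {t : ℤ // t ≤ T} p →L[ℝ] HpI {t : ℤ // t ≤ T} p),
              (∀ t τ : {t : ℤ // t ≤ T}, blk CNT t τ = blk (C N) (t : ℤ) (τ : ℤ)) →
              CNT.comp DNT = ContinuousLinearMap.id ℝ _ →
              DNT.comp CNT = ContinuousLinearMap.id ℝ _ →
              ∀ (CU DU : HpI {t : ℤ // t ≤ (0 : ℤ)} p →L[ℝ] HpI {t : ℤ // t ≤ (0 : ℤ)} p),
                (∀ t τ : {t : ℤ // t ≤ (0 : ℤ)},
                  blk CU t τ = Cr ((t : ℤ) - (τ : ℤ)) ((T : ℝ) / (N : ℝ))) →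
                CU.comp DU = ContinuousLinearMap.id ℝ _ →
                DU.comp CU = ContinuousLinearMap.id ℝ _ →
                specNorm ((blk DNT ⟨T, le_refl T⟩ ⟨T, le_refl T⟩)⁻¹ -
                    (blk DU ⟨0, le_refl 0⟩ ⟨0, le_refl 0⟩)⁻¹) ≤ 𝒦 / (N : ℝ) ∧
                ∀ j : ℕ, 1 ≤ j →
                  specNorm
                    (-(blk DNT ⟨T, le_refl T⟩ ⟨T, le_refl T⟩)⁻¹ *
                        blk DNT ⟨T, le_refl T⟩ ⟨T - (j : ℤ), by omega⟩ -
                      -(blk DU ⟨0, le_refl 0⟩ ⟨0, le_refl 0⟩)⁻¹ *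
                        blk DU ⟨0, le_refl 0⟩ ⟨-(j : ℤ), by omega⟩) ≤
                    𝒦 * zeta (j : ℝ) ^ (κ - 2) * min (2 * zeta (j : ℝ)) (1 / (N : ℝ)) := by
  set K' := max K 1 with hK'
  have hK0 : 0 < K' := zero_lt_one.trans_le (le_max_right _ _)
  obtain ⟨c, hc, hdecay⟩ := inverseDecay_sub_one hκ hK0 hInf
  set m := (lamInf / (K' * guSum κ) ^ 2)⁻¹ with hm
  have hm0 : 0 < m := inv_pos.mpr
    (div_pos hInf (pow_pos (mul_pos hK0 (guSum_pos (by linarith))) 2))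
  have hc1 := convConst_pos (show 1 < κ - 1 by linarith)
  have hc2 := convConst_pos (show 1 < κ - 2 by linarith)
  set d := c * (c * convConst (κ - 1)) * convConst (κ - 2) * (2 * K') with hd
  have hd0 : 0 < d := by positivity
  refine ⟨m * d * m + m * d * m * c + m * d + 2 * m * c, by positivity, ?_⟩
  intro p _ C Cr hLS N hN hN1 T CNT DNT hCNT hCD hDC CU DU hCU hCUD hDUC
  have hNpos : (0 : ℝ) < N := by exact_mod_cast hN1
  have hKK' : K ≤ K' := le_max_left _ _
  have hA : CoerciveDecay K' κ lamInf (fun t : {t : ℤ // t ≤ T} => (t : ℤ)) CNT DNT :=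
    { inj := Subtype.val_injective
      decay := fun i l => by
        rw [blkCLM, hCNT, norm_toEuclideanCLM_eq_specNorm]
        exact (hLS.decay N hN1 i l).trans
          (mul_le_mul_of_nonneg_right hKK' (gu_rpow_pos _ _).le)
      coercive := (kernelCoercive_of_coercive (hLS.lower N hN)).coercive
        Subtype.val_injective hCNT
      right_inv := fun v => congrArg (fun L => L v) hCD
      left_inv := fun v => congrArg (fun L => L v) hDC }
  have hB : CoerciveDecay K' κ lamInf (fun t : {t : ℤ // t ≤ (0 : ℤ)} => (t : ℤ)) CU DU :=
    { inj := Subtype.val_injective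
      decay := fun i l => by
        rw [blkCLM, hCU, norm_toEuclideanCLM_eq_specNorm]
        refine (hLS.crBound _ _).trans ?_
        rw [Int.cast_sub]
        exact mul_le_mul_of_nonneg_right hKK' (gu_rpow_pos _ _).le
      coercive := (hLS.kernelCoercive_stationary hN hN1 T).coercive
        Subtype.val_injective hCU
      right_inv := fun v => congrArg (fun L => L v) hCUD
      left_inv := fun v => congrArg (fun L => L v) hDUC }
  set σ : {t : ℤ // t ≤ T} ≃ {t : ℤ // t ≤ (0 : ℤ)} :=
    (Equiv.subRight T).subtypeEquiv fun t => by simp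
  have hσv : ∀ i, ((σ i : ℤ)) = i - T := fun _ => rfl
  have hcomp : ∀ k, specNorm (blk DNT ⟨T, le_refl T⟩ k - blk DU (σ ⟨T, le_refl T⟩) (σ k)) ≤
      d / N * gu ((T : ℝ) - (k : ℤ)) ^ (-(κ - 2)) := by
    intro k
    have h := hA.norm_blkCLM_sub_le hB hκ (δ := 2 * K' / N) hc (by positivity)
      (hdecay _ _ _ _ _ hA) (hdecay _ _ _ _ _ hB) σ (fun i l => by rw [hσv, hσv]; ring)
      ⟨T, le_refl T⟩ (fun i l => ?_) k
    · rw [blkCLM, blkCLM, ← map_sub, norm_toEuclideanCLM_eq_specNorm] at h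
      refine h.trans (le_of_eq ?_)
      rw [hd]
      ring
    · rw [blkCLM, blkCLM, ← map_sub, norm_toEuclideanCLM_eq_specNorm, specNorm_sub_comm, hCNT,
        hCU, hσv, hσv, sub_sub_sub_cancel_right]
      refine (hLS.specNorm_blk_sub_le hN1 _ _ _).trans ?_
      have h1 : 1 / (N : ℝ) + |((i : ℤ) : ℝ) / N - (T : ℝ) / N| ≤
          2 / N * gu ((T : ℝ) - (i : ℤ)) := by
        rw [← sub_div, abs_div, abs_of_pos hNpos, abs_sub_comm, ← add_div, div_mul_eq_mul_div]
        refine div_le_div_of_nonneg_right ?_ hNpos.le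
        linarith [one_le_gu ((T : ℝ) - (i : ℤ)), abs_le_gu ((T : ℝ) - (i : ℤ))]
      calc _ ≤ K' * gu (((i : ℤ) : ℝ) - (l : ℤ)) ^ (-(κ - 1)) *
            (2 / N * gu ((T : ℝ) - (i : ℤ))) :=
            mul_le_mul (mul_le_mul_of_nonneg_right hKK' (gu_rpow_pos _ _).le) h1
              (by positivity) (mul_nonneg hK0.le (gu_rpow_pos _ _).le)
        _ = _ := by ring
  have hσT : σ ⟨T, le_refl T⟩ = ⟨0, le_refl 0⟩ := Subtype.ext (by rw [hσv]; simp)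
  obtain ⟨hXu, hXm⟩ := hA.inv_blk_diag (by linarith) hK0 hInf ⟨T, le_refl T⟩
  obtain ⟨hYu, hYm⟩ := hB.inv_blk_diag (by linarith) hK0 hInf ⟨0, le_refl 0⟩
  rw [← hm] at hXm hYm
  have hXY : specNorm (blk DNT ⟨T, le_refl T⟩ ⟨T, le_refl T⟩ -
      blk DU ⟨0, le_refl 0⟩ ⟨0, le_refl 0⟩) ≤ d / N := by
    have h := hcomp ⟨T, le_refl T⟩
    rw [hσT] at h
    simpa [gu] using h
  have hinv := specNorm_inv_sub_inv_le hXu hYu hXm hYm hXY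
  refine ⟨?_, fun j hj => ?_⟩
  · refine hinv.trans ?_
    rw [← mul_div_assoc, div_mul_eq_mul_div]
    refine div_le_div_of_nonneg_right ?_ hNpos.le
    have : 0 ≤ m * d * m * c + m * d + 2 * m * c := by positivity
    linarith
  · have hσj : σ ⟨T - (j : ℤ), by omega⟩ = ⟨-(j : ℤ), by omega⟩ :=
      Subtype.ext (by rw [hσv]; simp)
    have hPQ := hcomp ⟨T - (j : ℤ), by omega⟩
    rw [hσT, hσj] at hPQ
    have hP := hdecay _ _ _ _ _ hA ⟨T, le_refl T⟩ ⟨T - (j : ℤ), by omega⟩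
    have hQ := hdecay _ _ _ _ _ hB ⟨0, le_refl 0⟩ ⟨-(j : ℤ), by omega⟩
    rw [blkCLM, norm_toEuclideanCLM_eq_specNorm] at hP hQ
    push_cast at hPQ hP hQ
    rw [sub_sub_cancel] at hPQ hP
    rw [sub_neg_eq_add, zero_add] at hQ
    set g1 := gu (j : ℝ) ^ (-(κ - 1)) with hg1
    set g2 := gu (j : ℝ) ^ (-(κ - 2)) with hg2
    have hg10 : 0 < g1 := gu_rpow_pos _ _
    have hg20 : 0 < g2 := gu_rpow_pos _ _
    have hg12 : g1 ≤ g2 := gu_rpow_anti _ (by linarith)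
    have hz1 : g1 ≤ zeta j ^ (κ - 2) * zeta j := by
      rw [← Real.rpow_add_one (zeta_pos _).ne', show κ - 2 + 1 = κ - 1 by ring]
      exact gu_rpow_neg_le_zeta_rpow _ (by linarith)
    have hz2 : g2 ≤ zeta j ^ (κ - 2) := gu_rpow_neg_le_zeta_rpow _ (by linarith)
    have hzp : 0 < zeta (j : ℝ) := zeta_pos _
    have hzp2 : 0 < zeta (j : ℝ) ^ (κ - 2) := Real.rpow_pos_of_pos hzp _
    rcases min_cases (2 * zeta (j : ℝ)) (1 / (N : ℝ)) with ⟨hmin, -⟩ | ⟨hmin, -⟩ <;> rw [hmin]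
    · refine (specNorm_neg_inv_mul_sub_le_add hXm hYm hP hQ).trans ?_
      calc m * (c * g1) + m * (c * g1) = 2 * m * c * g1 := by ring
        _ ≤ 2 * m * c * (zeta j ^ (κ - 2) * zeta j) :=
            mul_le_mul_of_nonneg_left hz1 (by positivity)
        _ ≤ (2 * (m * d * m + m * d * m * c + m * d + 2 * m * c)) *
            (zeta j ^ (κ - 2) * zeta j) := by
            refine mul_le_mul_of_nonneg_right ?_ (by positivity)
            have : 0 ≤ m * d * m + m * d * m * c + m * d + m * c := by positivity
            linarith
        _ = _ := by ring
    · refine (specNorm_neg_inv_mul_sub_le hYm hinv hP hPQ).trans ?_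
      calc m * (d / N) * m * (c * g1) + m * (d / N * g2)
          ≤ m * (d / N) * m * (c * g2) + m * (d / N * g2) := by gcongr
        _ = (m * d * m * c + m * d) * g2 * (1 / N) := by ring
        _ ≤ (m * d * m + m * d * m * c + m * d + 2 * m * c) * zeta j ^ (κ - 2) * (1 / N) := by
            refine mul_le_mul_of_nonneg_right (mul_le_mul ?_ hz2 hg20.le (by positivity))
              (by positivity)
            have : 0 ≤ m * d * m + 2 * m * c := by positivity
            linarith
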